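/- Assume n ≥ 1 and fix arities r_1, ..., r_k ≥ 1 with sum r. Let A_1, ..., A_n and B be structures each carrying relations R_j ⊆ (Fin r_j → ·) for j = 1, ..., k. For such a structure A, let A^† be the structure with domain Option A and a single relation of arity 1 + r, namely {s ++ t : s ∈ P^{A*}, t ∈ R^{A*}}, the set of concatenations of a tuple of the unary relation of A* with a tuple of the r-ary relation of A*. Then there is a homomorphism from the direct product of A_1, ..., A_n to B if and only if there is a homomorphism from the direct product of A_1^†, ..., A_n^† to B^†. -/

import Mathlib

/-- Sum of the arities of the relations preceding the `j`-th one. -/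
def blockOffset {k : ℕ} (r : Fin k → ℕ) (j : Fin k) : ℕ :=
  ∑ j' ∈ Finset.Iio j, r j'

lemma blockOffset_add_le {k : ℕ} (r : Fin k → ℕ) (j : Fin k) :
    blockOffset r j + r j ≤ ∑ j', r j' := by
  have : blockOffset r j + r j = ∑ j' ∈ insert j (Finset.Iio j), r j' := by
    rw [Finset.sum_insert (by simp), blockOffset]; omega
  rw [this]
  exact Finset.sum_le_sum_of_subset (Finset.subset_univ _)

/-- The padded tuple of arity `∑ j', r j'` whose entries on the `j`-th block of
positions are `some (t ·)` and whose entries elsewhere are `none`. -/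
def padded {k : ℕ} (r : Fin k → ℕ) {A : Type} (j : Fin k) (t : Fin (r j) → A)
    (p : Fin (∑ j', r j')) : Option A :=
  if hp : blockOffset r j ≤ (p : ℕ) ∧ (p : ℕ) < blockOffset r j + r j
  then some (t ⟨(p : ℕ) - blockOffset r j, by omega⟩)
  else none

/-- The single relation of arity `∑ j', r j'` of the structure `A*`: the constant
`none` tuple together with all padded tuples of tuples of the relations of `A`. -/
def starRel {k : ℕ} (r : Fin k → ℕ) {A : Type} (R : ∀ j, Set (Fin (r j) → A)) :
    Set (Fin (∑ j', r j') → Option A) :=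
  {v | (v = fun _ => none) ∨ ∃ j, ∃ t ∈ R j, v = padded r j t}

/-- The single relation of arity `1 + ∑ j', r j'` of the structure `A†`: all
concatenations `s ++ t` of a tuple `s` of the unary relation `P^{A*}` (a
constant `some a` tuple) with a tuple `t` of the relation `R^{A*}` of the star
construction. -/
def daggerRel {k : ℕ} (r : Fin k → ℕ) {A : Type} (R : ∀ j, Set (Fin (r j) → A)) :
    Set (Fin (1 + ∑ j', r j') → Option A) :=
  {u | ∃ s : Fin 1 → Option A, (∃ a : A, s = fun _ => some a) ∧
       ∃ t ∈ starRel r R, u = Fin.append s t}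

lemma blockOffset_lt {k : ℕ} (r : Fin k → ℕ) {j j' : Fin k} (h : j < j') :
    blockOffset r j + r j ≤ blockOffset r j' := by
  have : blockOffset r j + r j = ∑ j' ∈ insert j (Finset.Iio j), r j' := by
    rw [Finset.sum_insert (by simp), blockOffset]; omega
  rw [this, blockOffset]
  apply Finset.sum_le_sum_of_subset
  intro x hx
  simp only [Finset.mem_insert, Finset.mem_Iio] at hx ⊢
  rcases hx with rfl | hx
  · exact h
  · exact hx.trans h

lemma block_unique {k : ℕ} (r : Fin k → ℕ) {j j' : Fin k} {p : ℕ}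
    (h : blockOffset r j ≤ p ∧ p < blockOffset r j + r j)
    (h' : blockOffset r j' ≤ p ∧ p < blockOffset r j' + r j') : j = j' := by
  rcases lt_trichotomy j j' with hl | hl | hl
  · have := blockOffset_lt r hl; omega
  · exact hl
  · have := blockOffset_lt r hl; omega

/-- The `q`-th position of the `j`-th block. -/
def blockPos {k : ℕ} (r : Fin k → ℕ) (j : Fin k) (q : Fin (r j)) : Fin (∑ j', r j') :=
  ⟨blockOffset r j + q, by have := blockOffset_add_le r j; omega⟩

lemma padded_pos {k : ℕ} (r : Fin k → ℕ) {A : Type} (j : Fin k) (t : Fin (r j) → A)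
    (q : Fin (r j)) : padded r j t (blockPos r j q) = some (t q) := by
  unfold padded blockPos
  rw [dif_pos (by simp)]
  simp

lemma padded_some {k : ℕ} (r : Fin k → ℕ) {A : Type} {j : Fin k} {t : Fin (r j) → A}
    {p : Fin (∑ j', r j')} {a : A} (h : padded r j t p = some a) :
    blockOffset r j ≤ (p : ℕ) ∧ (p : ℕ) < blockOffset r j + r j := by
  unfold padded at h
  split_ifs at h with hp
  exact hp

lemma mem_dagger {k : ℕ} (r : Fin k → ℕ) {A : Type} (R : ∀ j, Set (Fin (r j) → A))
    (u : Fin (1 + ∑ j', r j') → Option A) :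
    u ∈ daggerRel r R ↔ (∃ a, u (Fin.castAdd _ 0) = some a) ∧
      (fun p => u (Fin.natAdd 1 p)) ∈ starRel r R := by
  constructor
  · rintro ⟨s, ⟨a, rfl⟩, t, ht, rfl⟩
    simpa using ht
  · rintro ⟨⟨a, ha⟩, h⟩
    refine ⟨fun _ => some a, ⟨a, rfl⟩, _, h, ?_⟩
    funext p
    refine Fin.addCases (fun q => ?_) (fun q => ?_) p
    · rw [Fin.append_left, Subsingleton.elim q 0, ha]
    · rw [Fin.append_right]

theorem stmt_14 (n : ℕ) (hn : 1 ≤ n) (k : ℕ) (r : Fin k → ℕ) (hr : ∀ j, 1 ≤ r j)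
    (A : Fin n → Type) (B : Type)
    (RA : ∀ i, ∀ j, Set (Fin (r j) → A i)) (RB : ∀ j, Set (Fin (r j) → B)) :
    (∃ h : (∀ i, A i) → B, ∀ (j : Fin k) (t : Fin (r j) → ∀ i, A i),
        (∀ i, (fun p => t p i) ∈ RA i j) → (fun p => h (t p)) ∈ RB j) ↔
    (∃ g : (∀ i, Option (A i)) → Option B,
        ∀ w : Fin (1 + ∑ j', r j') → ∀ i, Option (A i),
          (∀ i, (fun p => w p i) ∈ daggerRel r (RA i)) →
          (fun p => g (w p)) ∈ daggerRel r RB) := by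
  classical
  simp only [mem_dagger]
  constructor
  · rintro ⟨h, hh⟩
    let g : (∀ i, Option (A i)) → Option B := fun x =>
      if hx : ∀ i, (x i).isSome then some (h fun i => (x i).get (hx i)) else none
    have g_some : ∀ a : ∀ i, A i, g (fun i => some (a i)) = some (h a) := by
      intro a; simp [g]
    have g_none : ∀ x i, x i = none → g x = none := by
      intro x i hx
      simp only [g]
      rw [dif_neg]
      intro hc
      simpa [hx] using hc i
    refine ⟨g, fun w hw => ⟨?_, ?_⟩⟩
    · choose a ha using fun i => (hw i).1
      exact ⟨h a, by rw [← g_some]; exact congrArg g (funext ha)⟩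
    · by_cases hc : ∃ p a, g (w (Fin.natAdd 1 p)) = some a
      · obtain ⟨p, b, hp⟩ := hc
        have hns : ∀ i, ∃ a, w (Fin.natAdd 1 p) i = some a := by
          intro i
          rw [← Option.ne_none_iff_exists']
          intro hc
          rw [g_none _ i hc] at hp
          cases hp
        have key : ∀ i, ∃ j, ∃ t ∈ RA i j, (fun p => w (Fin.natAdd 1 p) i) = padded r j t := by
          intro i
          rcases (hw i).2 with h0 | h1
          · obtain ⟨a, ha⟩ := hns i
            have := congrFun h0 p
            simp [ha] at this
          · exact h1
        obtain ⟨j, hj⟩ : ∃ j, ∀ i, ∃ t ∈ RA i j,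
            (fun p => w (Fin.natAdd 1 p) i) = padded r j t := by
          obtain ⟨j, t, ht, e⟩ := key ⟨0, hn⟩
          refine ⟨j, fun i => ?_⟩
          obtain ⟨j', t', ht', e'⟩ := key i
          obtain ⟨a, ha⟩ := hns ⟨0, hn⟩
          obtain ⟨a', ha'⟩ := hns i
          have e1 := congrFun e p
          have e2 := congrFun e' p
          simp only [ha] at e1
          simp only [ha'] at e2
          obtain rfl := block_unique r (padded_some r e1.symm) (padded_some r e2.symm)
          exact ⟨t', ht', e'⟩
        choose t ht e using hj
        refine Or.inr ⟨j, fun q => h fun i => t i q, hh j (fun q i => t i q) ht, ?_⟩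
        funext q
        have hwq : w (Fin.natAdd 1 q) = fun i => padded r j (t i) q :=
          funext fun i => congrFun (e i) q
        simp only [hwq]
        by_cases hq : blockOffset r j ≤ (q : ℕ) ∧ (q : ℕ) < blockOffset r j + r j
        · simp only [padded, dif_pos hq]
          exact g_some _
        · rw [g_none _ ⟨0, hn⟩ (by simp only [padded, dif_neg hq])]
          simp only [padded, dif_neg hq]
      · left
        funext p
        by_contra hne
        exact hc ⟨p, Option.ne_none_iff_exists'.1 hne⟩
  · rintro ⟨g, hg⟩
    have hs : ∀ a : ∀ i, A i, ∃ b, g (fun i => some (a i)) = some b := by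
      intro a
      have := (hg (Fin.append (fun _ i => some (a i)) (fun _ _ => none)) (fun i => by
        simp [starRel])).1
      simpa using this
    choose h hh using hs
    refine ⟨h, fun j t ht => ?_⟩
    have := (hg (Fin.append (fun _ i => some (t ⟨0, hr j⟩ i))
      (fun p i => padded r j (fun q => t q i) p)) (fun i => by
        simp only [Fin.append_left, Fin.append_right]
        exact ⟨⟨_, rfl⟩, Or.inr ⟨j, _, ht i, rfl⟩⟩)).2
    simp only [Fin.append_right] at this
    have val : ∀ q, g (fun i => padded r j (fun q => t q i) (blockPos r j q)) = some (h (t q)) := by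
      intro q
      simp only [padded_pos]
      exact hh _
    rcases this with h0 | ⟨j', t', ht', e⟩
    · have := congrFun h0 (blockPos r j ⟨0, hr j⟩)
      simp [val] at this
    · have e0 := congrFun e (blockPos r j ⟨0, hr j⟩)
      simp only [val] at e0
      obtain rfl : j = j' := block_unique r
        (padded_some r (padded_pos r j (t) ⟨0, hr j⟩)) (padded_some r e0.symm)
      convert ht' using 1
      funext q
      have eq := congrFun e (blockPos r j q)
      simp only [padded_pos] at eq
      exact Option.some.inj ((hh _).symm.trans eq)
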